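/- For every integer n >= 2, the total number of leaves (i.e., balanced vertices of rank 0) in all decreasing binary trees on [n] equals (n+1)!/3, that is, a(n,0) = (n+1)!/3. -/

import Mathlib

namespace BalancedTrees

/-- Plane binary trees with vertices labeled by natural numbers;
`nil` is the empty tree, and each child of a vertex is designated
as a left child or a right child. -/
inductive BT where
  | nil : BT
  | node (label : ℕ) (l r : BT) : BT
deriving DecidableEq

namespace BT

/-- `balRank t = some k` if and only if the root of `t` is a balanced vertex of
rank `k`, i.e. every descending path from the root to a leaf has length `k`. -/
def balRank : BT → Option ℕ
  | .nil => none
  | .node _ .nil .nil => some 0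
  | .node _ .nil (.node b rl rr) => (balRank (BT.node b rl rr)).map (· + 1)
  | .node _ (.node a ll lr) .nil => (balRank (BT.node a ll lr)).map (· + 1)
  | .node _ (.node a ll lr) (.node b rl rr) =>
      match balRank (BT.node a ll lr), balRank (BT.node b rl rr) with
      | some i, some j => if i = j then some (i + 1) else none
      | _, _ => none

/-- The number of balanced vertices of rank `k` in the tree `t`. -/
def countBal (k : ℕ) : BT → ℕ
  | .nil => 0
  | .node v l r =>
      countBal k l + countBal k r +
        (if balRank (BT.node v l r) = some k then 1 else 0)

/-- The number of balanced vertices (of any rank) in the tree `t`. -/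
def countBalAll : BT → ℕ
  | .nil => 0
  | .node v l r =>
      countBalAll l + countBalAll r +
        (if (balRank (BT.node v l r)).isSome then 1 else 0)

/-- Auxiliary, fuelled version of `treeOf`. -/
def treeOfAux : ℕ → List ℕ → BT
  | 0, _ => .nil
  | _ + 1, [] => .nil
  | fuel + 1, l =>
      let m := l.foldr max 0
      BT.node m (treeOfAux fuel (l.takeWhile (· != m)))
                (treeOfAux fuel ((l.dropWhile (· != m)).tail))

/-- The decreasing binary tree `T(π)` of a sequence `π` of distinct labels:
the root is the maximum entry, and its left (resp. right) subtree is built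
recursively from the part of the sequence to the left (resp. right) of the
maximum. This is a bijection between permutations of `{1,…,n}` and
decreasing binary trees on `{1,…,n}`. -/
def treeOf (l : List ℕ) : BT := treeOfAux l.length l

/-- Canonical form for non-plane 1-2 trees (as represented by plane trees):
an only child is stored as a left child, and of two (unordered) children the
one with the larger label is stored on the left. Decreasing binary trees in
canonical form are in bijection with non-plane 1-2 trees. -/
def canonNP : BT → Bool
  | .nil => true
  | .node _ l r =>
      canonNP l && canonNP r &&
        (match l, r with
         | .nil, .nil => true
         | .node _ _ _, .nil => true
         | .nil, .node _ _ _ => false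
         | .node a _ _, .node b _ _ => decide (b < a))

/-- Canonical form for plane 1-2 trees: an only child is stored as a left
child (an only child carries no left/right designation), while two children
remain ordered. Decreasing binary trees in canonical form are in bijection
with plane 1-2 trees. -/
def canonP : BT → Bool
  | .nil => true
  | .node _ l r =>
      canonP l && canonP r &&
        (match l, r with
         | .nil, .node _ _ _ => false
         | _, _ => true)

end BT

open BT

/-- The list of all permutations of `{1,…,n}`, each written as a list. -/
def perms (n : ℕ) : List (List ℕ) := (List.range' 1 n).permutations

/-- `a n k`: the total number of balanced vertices of rank `k` over all
decreasing binary trees on `{1,…,n}`. -/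
def a (n k : ℕ) : ℕ := ((perms n).map fun l => countBal k (treeOf l)).sum

/-- `r n k`: the number of decreasing binary trees on `{1,…,n}` whose root is
balanced of rank `k`. -/
def r (n k : ℕ) : ℕ :=
  ((perms n).filter fun l => decide (balRank (treeOf l) = some k)).length

/-- `p n k`: the probability that the root of a uniformly random decreasing
binary tree on `{1,…,n}` is balanced of rank `k`; by convention `p 0 k = 1`. -/
def p (n k : ℕ) : ℚ := if n = 0 then 1 else (r n k : ℚ) / (Nat.factorial n : ℚ)

/-- The number of decreasing binary trees on `{1,…,n}` whose root is balanced. -/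
def rootBal (n : ℕ) : ℕ :=
  ((perms n).filter fun l => (balRank (treeOf l)).isSome).length

/-- `proot n`: the probability that the root of a uniformly random decreasing
binary tree on `{1,…,n}` is balanced. -/
def proot (n : ℕ) : ℚ := (rootBal n : ℚ) / (Nat.factorial n : ℚ)

/-- The total number of balanced vertices over all decreasing binary trees
on `{1,…,n}`. -/
def totalBal (n : ℕ) : ℕ := ((perms n).map fun l => countBalAll (treeOf l)).sum

/-- `Pbal n`: the probability that a vertex chosen uniformly at random from
the `n * n!` vertices of all decreasing binary trees on `{1,…,n}` is balanced. -/
def Pbal (n : ℕ) : ℚ := (totalBal n : ℚ) / ((n : ℚ) * (Nat.factorial n : ℚ))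

/-- Permutations whose decreasing binary tree is a canonical representative
of a non-plane 1-2 tree; these are in bijection with non-plane 1-2 trees
on `{1,…,n}`. -/
def npPerms (n : ℕ) : List (List ℕ) := (perms n).filter fun l => canonNP (treeOf l)

/-- `E n`: the number of non-plane 1-2 trees on `{1,…,n}` (the Euler number). -/
def E (n : ℕ) : ℕ := (npPerms n).length

/-- `b n k`: the total number of balanced vertices of rank `k` over all
non-plane 1-2 trees on `{1,…,n}`. -/
def b (n k : ℕ) : ℕ := ((npPerms n).map fun l => countBal k (treeOf l)).sum

/-- `s n k`: the number of non-plane 1-2 trees on `{1,…,n}` whose root is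
balanced of rank `k`. -/
def s (n k : ℕ) : ℕ :=
  ((npPerms n).filter fun l => decide (balRank (treeOf l) = some k)).length

/-- Permutations whose decreasing binary tree is a canonical representative
of a plane 1-2 tree; these are in bijection with plane 1-2 trees on `{1,…,n}`. -/
def pPerms (n : ℕ) : List (List ℕ) := (perms n).filter fun l => canonP (treeOf l)

/-- `z n`: the number of plane 1-2 trees on `{1,…,n}`. -/
def z (n : ℕ) : ℕ := (pPerms n).length

/-- `d n k`: the total number of balanced vertices of rank `k` over all
plane 1-2 trees on `{1,…,n}`. -/
def d (n k : ℕ) : ℕ := ((pPerms n).map fun l => countBal k (treeOf l)).sum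

/-- `t n k`: the number of plane 1-2 trees on `{1,…,n}` whose root is
balanced of rank `k`. -/
def t (n k : ℕ) : ℕ :=
  ((pPerms n).filter fun l => decide (balRank (treeOf l) = some k)).length

end BalancedTrees

open BalancedTrees

namespace BalancedTrees

namespace BT

theorem balRank_node_eq_some_zero (v : ℕ) (l r : BT) :
    balRank (node v l r) = some 0 ↔ l = nil ∧ r = nil := by
  rcases l with _ | ⟨a, ll, lr⟩ <;> rcases r with _ | ⟨b, rl, rr⟩ <;> simp [balRank]
  split <;> simp

theorem countBal_zero_node (v : ℕ) (l r : BT) :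
    countBal 0 (node v l r) =
      countBal 0 l + countBal 0 r + if l = nil ∧ r = nil then 1 else 0 := by
  simp only [countBal, balRank_node_eq_some_zero]

theorem foldr_max_append_cons {A B : List ℕ} {M : ℕ} (hA : ∀ x ∈ A, x < M)
    (hB : ∀ x ∈ B, x ≤ M) : (A ++ M :: B).foldr max 0 = M := by
  induction A with
  | nil =>
    have h : B.foldr max 0 ≤ M := by
      induction B with
      | nil => simp
      | cons b B ih => simp_all
    simpa using h
  | cons x A ih =>
    have hx := hA x (by simp)
    rw [List.cons_append, List.foldr_cons, ih fun y hy => hA y (by simp [hy])]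
    omega

theorem treeOfAux_succ_append_cons (f : ℕ) {A B : List ℕ} {M : ℕ} (hA : ∀ x ∈ A, x < M)
    (hB : ∀ x ∈ B, x ≤ M) :
    treeOfAux (f + 1) (A ++ M :: B) = node M (treeOfAux f A) (treeOfAux f B) := by
  have hA' : ∀ x ∈ A, (x != M) = true := fun x hx => by simpa using (hA x hx).ne
  rw [treeOfAux]
  · simp only [foldr_max_append_cons hA hB]
    rw [List.takeWhile_append_of_pos hA', List.dropWhile_append_of_pos hA']
    simp
  · simp

/-- A nonempty list splits at the first occurrence of its maximum. -/
theorem exists_eq_append_max_cons {l : List ℕ} (hl : l ≠ []) :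
    ∃ A M B, l = A ++ M :: B ∧ (∀ x ∈ A, x < M) ∧ ∀ x ∈ B, x ≤ M := by
  induction l with
  | nil => exact absurd rfl hl
  | cons x l ih =>
    rcases eq_or_ne l [] with rfl | h
    · exact ⟨[], x, [], by simp⟩
    obtain ⟨A, M, B, rfl, hA, hB⟩ := ih h
    rcases lt_or_ge x M with hx | hx
    · exact ⟨x :: A, M, B, by simp, by simpa [hx] using hA, hB⟩
    · refine ⟨[], x, A ++ M :: B, by simp, by simp, fun y hy => ?_⟩
      simp only [List.mem_append, List.mem_cons] at hy
      rcases hy with hy | rfl | hy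
      · exact (hA y hy).le.trans hx
      · exact hx
      · exact (hB y hy).trans hx

/-- Induction on lists by splitting at the first occurrence of the maximum. -/
theorem max_split_induction {P : List ℕ → Prop} (nil : P [])
    (split : ∀ A M B, (∀ x ∈ A, x < M) → (∀ x ∈ B, x ≤ M) → P A → P B → P (A ++ M :: B))
    (l : List ℕ) : P l := by
  induction h : l.length using Nat.strong_induction_on generalizing l with
  | _ n ih =>
    rcases eq_or_ne l [] with rfl | hl
    · exact nil
    obtain ⟨A, M, B, rfl, hA, hB⟩ := exists_eq_append_max_cons hl
    simp only [List.length_append, List.length_cons] at h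
    exact split A M B hA hB (ih _ (by omega) A rfl) (ih _ (by omega) B rfl)

theorem treeOfAux_eq_treeOf (l : List ℕ) : ∀ f, l.length ≤ f → treeOfAux f l = treeOf l := by
  induction l using max_split_induction with
  | nil => intro f _; cases f <;> rfl
  | split A M B hA hB ihA ihB =>
    intro f hf
    have h : (A ++ M :: B).length = (A.length + B.length) + 1 := by simp; omega
    obtain ⟨f, rfl⟩ : ∃ g, f = g + 1 := ⟨f - 1, by omega⟩
    rw [treeOf, h, treeOfAux_succ_append_cons _ hA hB, treeOfAux_succ_append_cons _ hA hB,
      ihA _ (by omega), ihB _ (by omega), ihA _ (by omega), ihB _ (by omega)]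

theorem treeOf_append_cons {A B : List ℕ} {M : ℕ} (hA : ∀ x ∈ A, x < M)
    (hB : ∀ x ∈ B, x ≤ M) : treeOf (A ++ M :: B) = node M (treeOf A) (treeOf B) := by
  have h : (A ++ M :: B).length = (A.length + B.length) + 1 := by simp; omega
  rw [treeOf, h, treeOfAux_succ_append_cons _ hA hB, treeOfAux_eq_treeOf A _ (by omega),
    treeOfAux_eq_treeOf B _ (by omega)]

theorem treeOf_eq_nil {l : List ℕ} : treeOf l = nil ↔ l = [] := by
  refine ⟨fun h => ?_, fun h => h ▸ rfl⟩
  by_contra hl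
  obtain ⟨A, M, B, rfl, hA, hB⟩ := exists_eq_append_max_cons hl
  simp [treeOf_append_cons hA hB] at h

theorem countBal_zero_treeOf_append_cons {A B : List ℕ} {M : ℕ} (hA : ∀ x ∈ A, x < M)
    (hB : ∀ x ∈ B, x ≤ M) :
    countBal 0 (treeOf (A ++ M :: B)) =
      countBal 0 (treeOf A) + countBal 0 (treeOf B) + if A = [] ∧ B = [] then 1 else 0 := by
  rw [treeOf_append_cons hA hB, countBal_zero_node]
  simp only [treeOf_eq_nil]

theorem permutations'Aux_append_cons (m M : ℕ) (A B : List ℕ) :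
    List.permutations'Aux m (A ++ M :: B) =
      (List.permutations'Aux m A).map (· ++ M :: B) ++
        (List.permutations'Aux m B).map (fun t => A ++ M :: t) := by
  induction A with
  | nil => simp
  | cons x A ih => simp [ih, Function.comp_def]

theorem perm_of_mem_permutations'Aux {m : ℕ} {l t : List ℕ}
    (h : t ∈ List.permutations'Aux m l) : t.Perm (m :: l) := by
  have : t ∈ (m :: l).permutations' := by
    simp only [List.permutations', List.mem_flatMap]
    exact ⟨l, by simp, h⟩
  exact List.mem_permutations'.1 this

/-- Inserting a new minimum next to a leaf (two positions for each leaf) preserves the number of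
leaves; inserting it at any other position increases that number by one. -/
theorem sum_leaves_permutations'Aux (m : ℕ) (l : List ℕ) (hl : ∀ x ∈ l, m < x) :
    ((List.permutations'Aux m l).map fun t => countBal 0 (treeOf t)).sum +
        2 * countBal 0 (treeOf l) =
      (l.length + 1) * (countBal 0 (treeOf l) + 1) := by
  induction l using max_split_induction with
  | nil => simp [treeOf, treeOfAux, countBal, balRank]
  | split A M B hA hB ihA ihB =>
    have hm : m < M := hl M (by simp)
    have ihA := ihA fun x hx => hl x (by simp [hx])
    have ihB := ihB fun x hx => hl x (by simp [hx])
    have eA : ∀ t ∈ List.permutations'Aux m A, countBal 0 (treeOf (t ++ M :: B)) =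
        countBal 0 (treeOf t) + countBal 0 (treeOf B) := by
      intro t ht
      have hp := perm_of_mem_permutations'Aux ht
      rw [countBal_zero_treeOf_append_cons _ hB, if_neg]
      · rfl
      · rintro ⟨rfl, -⟩
        simpa using hp.length_eq
      · intro x hx
        rcases List.mem_cons.1 (hp.mem_iff.1 hx) with rfl | hx
        exacts [hm, hA x hx]
    have eB : ∀ t ∈ List.permutations'Aux m B, countBal 0 (treeOf (A ++ M :: t)) =
        countBal 0 (treeOf A) + countBal 0 (treeOf t) := by
      intro t ht
      have hp := perm_of_mem_permutations'Aux ht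
      rw [countBal_zero_treeOf_append_cons hA, if_neg]
      · rfl
      · rintro ⟨-, rfl⟩
        simpa using hp.length_eq
      · intro x hx
        rcases List.mem_cons.1 (hp.mem_iff.1 hx) with rfl | hx
        exacts [hm.le, hB x hx]
    rw [permutations'Aux_append_cons, List.map_append, List.sum_append, List.map_map,
      List.map_map, countBal_zero_treeOf_append_cons hA hB]
    simp only [Function.comp_def]
    rw [List.map_congr_left eA, List.map_congr_left eB, List.sum_map_add, List.sum_map_add]
    simp only [List.map_const', List.sum_replicate, smul_eq_mul, List.length_permutations'Aux,
      List.length_append, List.length_cons]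
    split_ifs with h
    · obtain ⟨rfl, rfl⟩ := h
      simp [treeOf, treeOfAux, countBal, balRank]
    · linear_combination ihA + ihB

end BT

open BT

theorem sum_leaves_permutations'_range'_succ (s n : ℕ) :
    ((List.range' s (n + 1)).permutations'.map fun l => countBal 0 (treeOf l)).sum +
        2 * ((List.range' (s + 1) n).permutations'.map fun l => countBal 0 (treeOf l)).sum =
      (n + 1) * ((List.range' (s + 1) n).permutations'.map fun l => countBal 0 (treeOf l)).sum +
        (n + 1).factorial := by
  have key : ∀ l ∈ (List.range' (s + 1) n).permutations',
      ((List.permutations'Aux s l).map fun t => countBal 0 (treeOf t)).sum +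
        2 * countBal 0 (treeOf l) = (n + 1) * countBal 0 (treeOf l) + (n + 1) := by
    intro l hl
    have hp := List.mem_permutations'.1 hl
    rw [sum_leaves_permutations'Aux s l, hp.length_eq, List.length_range', mul_add_one]
    intro x hx
    have := hp.mem_iff.1 hx
    rw [List.mem_range'_1] at this
    omega
  have hlen : (List.range' (s + 1) n).permutations'.length = n.factorial := by
    rw [← (List.permutations_perm_permutations' _).length_eq, List.length_permutations,
      List.length_range']
  have h := congrArg List.sum (List.map_congr_left key)
  rw [List.sum_map_add, List.sum_map_add, List.sum_map_mul_left, List.sum_map_mul_left,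
    List.map_const', List.sum_replicate, hlen, smul_eq_mul] at h
  rw [List.range'_succ, List.permutations', List.map_flatMap, List.flatMap_def, List.sum_flatten, List.map_map,
    Nat.factorial_succ, mul_comm (n + 1) n.factorial]
  exact h

theorem three_mul_sum_leaves (n : ℕ) : ∀ s,
    3 * ((List.range' s (n + 2)).permutations'.map fun l => countBal 0 (treeOf l)).sum =
      (n + 3).factorial := by
  induction n with
  | zero =>
    intro s
    have := sum_leaves_permutations'_range'_succ s 1
    simp only [Nat.factorial, Nat.reduceAdd, zero_add] at this ⊢
    omega
  | succ n ih =>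
    intro s
    have h := sum_leaves_permutations'_range'_succ s (n + 2)
    have ih := ih (s + 1)
    rw [show n + 1 + 3 = n + 3 + 1 by ring, Nat.factorial_succ]
    linear_combination 3 * h + (n + 1) * ih

end BalancedTrees

/-- For every `n ≥ 2`, the total number of leaves (balanced vertices of rank
`0`) in all decreasing binary trees on `{1,…,n}` equals `(n+1)!/3`. -/
theorem statement2 (n : ℕ) (hn : 2 ≤ n) :
    (a n 0 : ℚ) = (Nat.factorial (n + 1) : ℚ) / 3 := by
  obtain ⟨n, rfl⟩ := Nat.exists_eq_add_of_le' hn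
  have h := three_mul_sum_leaves n 1
  rw [← ((List.permutations_perm_permutations' (List.range' 1 (n + 2))).map _).sum_eq] at h
  rw [eq_div_iff (by norm_num), mul_comm]
  exact_mod_cast h
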